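/- Let u_λ be the viscosity solution of λu + H(x, −∇u) = 0 on 𝕋^d and φ_{N,λ} the solution of the discrete Bellman equation λφ + 𝓗_N(x, (−Δ_N)φ) = 0 on Λ_N. Then there is a constant C₁ depending only on L such that for every x ∈ Λ_N, |u_λ(x) − φ_{N,λ}(x)| ≤ C₁ λ^{−3/2} N^{−1/2}. -/

import Mathlib

open scoped BigOperators RealInnerProductSpace
open MeasureTheory Filter

noncomputable section

abbrev Evec (d : ℕ) := EuclideanSpace ℝ (Fin d)

def sgnz (a : ℝ) : ℤ := if 0 < a then 1 else if a < 0 then -1 else 0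

def latE (d N : ℕ) (x : Fin d → ZMod N) : Evec d :=
  (WithLp.equiv 2 (Fin d → ℝ)).symm fun i => ((x i).val : ℝ) / N

def dplus {d N : ℕ} (φ : (Fin d → ZMod N) → ℝ) (x : Fin d → ZMod N) (i : Fin d) : ℝ :=
  (N : ℝ) * (φ (x + Pi.single i 1) - φ x)

def dminus {d N : ℕ} (φ : (Fin d → ZMod N) → ℝ) (x : Fin d → ZMod N) (i : Fin d) : ℝ :=
  (N : ℝ) * (φ (x - Pi.single i 1) - φ x)

def DeltaN {d N : ℕ} (φ : (Fin d → ZMod N) → ℝ) (x : Fin d → ZMod N) : Fin d → ℝ × ℝ :=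
  fun i => (dplus φ x i, dminus φ x i)

def negDeltaN {d N : ℕ} (φ : (Fin d → ZMod N) → ℝ) (x : Fin d → ZMod N) : Fin d → ℝ × ℝ :=
  fun i => (-dplus φ x i, -dminus φ x i)

def pairL {d : ℕ} (ξ : Fin d → ℝ × ℝ) (v : Evec d) : ℝ :=
  ∑ i, ((ξ i).1 * max (v i) 0 + (ξ i).2 * max (-(v i)) 0)

def QN {d N : ℕ} (v : Evec d) (x y : Fin d → ZMod N) : ℝ :=
  (∑ i, if y = x + Pi.single i ((sgnz (v i) : ZMod N)) then (N : ℝ) * |v i| else 0)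
    - (if y = x then (N : ℝ) * ∑ i, |v i| else 0)

def HNlat {d N : ℕ} (L : Evec d → Evec d → ℝ) (x : Fin d → ZMod N)
    (ξ : Fin d → ℝ × ℝ) : ℝ :=
  ⨆ v : Evec d, (pairL ξ v - L (latE d N x) v)

def Ham (d : ℕ) (L : Evec d → Evec d → ℝ) (x p : Evec d) : ℝ :=
  ⨆ v : Evec d, (⟪p, v⟫ - L x v)

lemma per_zsmul {d : ℕ} (f : Evec d → ℝ)
    (hf : ∀ (x : Evec d) (i : Fin d), f (x + EuclideanSpace.single i 1) = f x)
    (a : Fin d → ℤ) (s : Finset (Fin d)) (x : Evec d) :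
    f (x - ∑ i ∈ s, a i • EuclideanSpace.single i (1 : ℝ)) = f x := by
  classical
  induction s using Finset.induction_on generalizing x with
  | empty => simp
  | insert i s hi ih =>
    have hp : Function.Periodic f (EuclideanSpace.single i (1 : ℝ)) := fun y => hf y i
    rw [Finset.sum_insert hi, ← sub_sub, ih, hp.sub_zsmul_eq]

lemma per_red {d : ℕ} (x : Evec d) : ∃ z : Evec d, ‖z‖ ≤ d ∧
    ∀ f : Evec d → ℝ, (∀ (x : Evec d) (i : Fin d), f (x + EuclideanSpace.single i 1) = f x) →
      f x = f z := by
  classical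
  refine ⟨x - ∑ i, ⌊x i⌋ • EuclideanSpace.single i (1 : ℝ), ?_, ?_⟩
  · have hc : ∀ j, (x - ∑ i, ⌊x i⌋ • EuclideanSpace.single i (1 : ℝ)) j = Int.fract (x j) := by
      intro j
      have := Int.self_sub_floor (x j)
      simp [Finset.sum_apply, Pi.single_apply]
    rw [EuclideanSpace.norm_eq]
    apply Real.sqrt_le_iff.2
    refine ⟨by positivity, ?_⟩
    have h1 : ∀ j ∈ (Finset.univ : Finset (Fin d)),
        ‖(x - ∑ i, ⌊x i⌋ • EuclideanSpace.single i (1 : ℝ)) j‖ ^ 2 ≤ 1 := by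
      intro j _
      rw [hc, Real.norm_eq_abs, sq_abs]
      have := Int.fract_nonneg (x j)
      have := (Int.fract_lt_one (x j)).le
      nlinarith
    have h2 := Finset.sum_le_card_nsmul _ _ _ h1
    simp only [Finset.card_univ, Fintype.card_fin, nsmul_eq_mul, mul_one] at h2
    refine h2.trans ?_
    have : d ≤ d ^ 2 := Nat.le_self_pow (by norm_num) d
    exact_mod_cast this
  · intro f hf
    exact (per_zsmul f hf _ _ x).symm

lemma L_bdd {d : ℕ} (L : Evec d → Evec d → ℝ) (hLc : Continuous (Function.uncurry L))
    (hper : ∀ (x v : Evec d) (i : Fin d), L (x + EuclideanSpace.single i 1) v = L x v) :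
    ∃ B : ℝ, ∀ x v, ‖v‖ ≤ 1 → L x v ≤ B := by
  obtain ⟨B, hB⟩ := ((isCompact_closedBall (0 : Evec d) d).prod
    (isCompact_closedBall (0 : Evec d) 1)).bddAbove_image hLc.continuousOn
  refine ⟨B, fun x v hv => ?_⟩
  obtain ⟨z, hz, hzf⟩ := per_red x
  rw [hzf (fun x => L x v) (fun x i => hper x v i)]
  exact hB ⟨(z, v), ⟨by simpa using hz, by simpa using hv⟩, rfl⟩

lemma u_max {d : ℕ} (u : Evec d → ℝ) (hu : Continuous u)
    (hper : ∀ (x : Evec d) (i : Fin d), u (x + EuclideanSpace.single i 1) = u x) :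
    ∃ y, ∀ z, u z ≤ u y := by
  obtain ⟨y, -, hy⟩ := (isCompact_closedBall (0 : Evec d) d).exists_isMaxOn
    ⟨0, by simp⟩ hu.continuousOn
  refine ⟨y, fun x => ?_⟩
  obtain ⟨z, hz, hzf⟩ := per_red x
  rw [hzf u hper]
  exact hy (by simpa using hz)

lemma grad_quad {d : ℕ} (k : ℝ) (q y : Evec d) :
    gradient (fun y : Evec d => k * ‖y - q‖ ^ 2) y = (2 * k) • (y - q) := by
  apply HasGradientAt.gradient
  rw [hasGradientAt_iff_hasFDerivAt]
  have h := (((hasFDerivAt_id y).sub_const q).norm_sq).const_mul k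
  refine h.congr_fderiv ?_
  ext v
  simp
  ring

lemma contDiff_quad {d : ℕ} (k : ℝ) (q : Evec d) :
    ContDiff ℝ 1 (fun y : Evec d => k * ‖y - q‖ ^ 2) :=
  contDiff_const.mul ((contDiff_id.sub contDiff_const).norm_sq ℝ)

lemma latE_shift {d N : ℕ} (x : Fin d → ZMod (N + 1)) (i : Fin d) :
    ∃ w : Evec d, (w = 0 ∨ w = EuclideanSpace.single i 1) ∧
      latE d (N + 1) (x + Pi.single i 1) + w
        = latE d (N + 1) x + EuclideanSpace.single i (1 / ((N : ℝ) + 1)) := by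
  have hv : (x i + 1).val = ((x i).val + 1) % (N + 1) := by
    rw [← ZMod.val_natCast]; simp
  have hlt := ZMod.val_lt (x i)
  have hn : (N : ℝ) + 1 ≠ 0 := by positivity
  rcases Nat.lt_or_ge ((x i).val + 1) (N + 1) with h | h
  · refine ⟨0, Or.inl rfl, ?_⟩
    rw [Nat.mod_eq_of_lt h] at hv
    ext j
    by_cases hj : j = i
    · subst hj
      simp only [latE, add_zero, PiLp.add_apply]
      simp [hv, -ZMod.natCast_val]
      ring
    · simp [latE, hj]
  · refine ⟨_, Or.inr rfl, ?_⟩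
    have h2 : (x i).val = N := by omega
    rw [h2, Nat.mod_self] at hv
    ext j
    by_cases hj : j = i
    · subst hj
      simp [latE, hv, h2, -ZMod.natCast_val]
      field_simp
    · simp [latE, hj]

lemma pairL_le {d : ℕ} (ξ : Fin d → ℝ × ℝ) (v : Evec d) (P : ℝ)
    (h1 : ∀ i, (ξ i).1 ≤ P) (h2 : ∀ i, (ξ i).2 ≤ P) (hP : 0 ≤ P) :
    pairL ξ v ≤ (d * P) * ‖v‖ := by
  have : ∀ i ∈ (Finset.univ : Finset (Fin d)),
      ((ξ i).1 * max (v i) 0 + (ξ i).2 * max (-(v i)) 0) ≤ P * ‖v‖ := by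
    intro i _
    have hn : |v i| ≤ ‖v‖ := by simpa using PiLp.norm_apply_le v i
    have e : max (v i) 0 + max (-(v i)) 0 = |v i| := by
      rcases le_total 0 (v i) with h | h
      · simp [h, abs_of_nonneg h]
      · simp [h, abs_of_nonpos h]
    have a1 : (ξ i).1 * max (v i) 0 ≤ P * max (v i) 0 :=
      mul_le_mul_of_nonneg_right (h1 i) (le_max_right _ _)
    have a2 : (ξ i).2 * max (-(v i)) 0 ≤ P * max (-(v i)) 0 :=
      mul_le_mul_of_nonneg_right (h2 i) (le_max_right _ _)
    have a3 := mul_le_mul_of_nonneg_left hn hP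
    rw [← e] at a3
    linarith
  have := Finset.sum_le_card_nsmul _ _ _ this
  simp only [Finset.card_univ, Fintype.card_fin, nsmul_eq_mul] at this
  unfold pairL
  linarith

/-- The continuous pairing is a special case of the lattice one. -/
lemma inner_eq_pairL {d : ℕ} (p v : Evec d) :
    ⟪p, v⟫ = pairL (fun i => (p i, -(p i))) v := by
  unfold pairL
  rw [PiLp.inner_apply]
  refine Finset.sum_congr rfl fun i _ => ?_
  rcases le_total 0 (v i) with h | h
  · simp [h]; ring
  · simp [h]; ring

lemma sum_max_le {d : ℕ} (v : Evec d) (k : ℝ) (hk : 0 ≤ k) :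
    pairL (fun _ => (k, k)) v ≤ d * k * ‖v‖ :=
  pairL_le _ _ _ (fun _ => le_rfl) (fun _ => le_rfl) hk

lemma pairL_mono {d : ℕ} (ξ ζ : Fin d → ℝ × ℝ) (v : Evec d)
    (h1 : ∀ i, (ξ i).1 ≤ (ζ i).1) (h2 : ∀ i, (ξ i).2 ≤ (ζ i).2) :
    pairL ξ v ≤ pairL ζ v := by
  unfold pairL
  refine Finset.sum_le_sum fun i _ => add_le_add ?_ ?_
  · exact mul_le_mul_of_nonneg_right (h1 i) (le_max_right _ _)
  · exact mul_le_mul_of_nonneg_right (h2 i) (le_max_right _ _)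

lemma pairL_add {d : ℕ} (ξ : Fin d → ℝ × ℝ) (k : ℝ) (v : Evec d) :
    pairL (fun i => ((ξ i).1 + k, (ξ i).2 + k)) v = pairL ξ v + pairL (fun _ => (k, k)) v := by
  unfold pairL
  rw [← Finset.sum_add_distrib]
  refine Finset.sum_congr rfl fun i _ => ?_
  ring

lemma pairL_bdd {d : ℕ} (L : Evec d → Evec d → ℝ) (g : ℝ → ℝ)
    (hsl : ∀ a : ℝ, 0 ≤ a → ∀ (x v : Evec d), a * ‖v‖ + g a ≤ L x v)
    (ξ : Fin d → ℝ × ℝ) (x : Evec d) :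
    BddAbove (Set.range fun v : Evec d => pairL ξ v - L x v) := by
  set P := ∑ i, (|(ξ i).1| + |(ξ i).2|) with hP
  have hP0 : 0 ≤ P := Finset.sum_nonneg fun i _ => by positivity
  have hi : ∀ i, |(ξ i).1| + |(ξ i).2| ≤ P := fun i =>
    Finset.single_le_sum (f := fun i => |(ξ i).1| + |(ξ i).2|)
      (fun i _ => by positivity) (Finset.mem_univ i)
  refine ⟨-g (d * P), ?_⟩
  rintro _ ⟨v, rfl⟩
  have h1 := pairL_le ξ v P
    (fun i => by linarith [hi i, le_abs_self (ξ i).1, abs_nonneg (ξ i).2])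
    (fun i => by linarith [hi i, le_abs_self (ξ i).2, abs_nonneg (ξ i).1]) hP0
  have h2 := hsl (d * P) (by positivity) x v
  simp only
  linarith

/-- Near-maximisers have bounded velocity. -/
lemma near_max {d : ℕ} (L : Evec d → Evec d → ℝ) (g : ℝ → ℝ)
    (hsl : ∀ a : ℝ, 0 ≤ a → ∀ (x v : Evec d), a * ‖v‖ + g a ≤ L x v)
    (B : ℝ) (hB : ∀ x v, ‖v‖ ≤ 1 → L x v ≤ B)
    (ξ : Fin d → ℝ × ℝ) (x : Evec d) (P : ℝ) (hP : 0 ≤ P)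
    (h1 : ∀ i, (ξ i).1 ≤ P) (h2 : ∀ i, (ξ i).2 ≤ P) (η : ℝ) (hη : 0 < η) (hη1 : η ≤ 1) :
    ∃ v : Evec d, ‖v‖ ≤ B + 1 - g (d * P + 1) ∧
      (⨆ v : Evec d, (pairL ξ v - L x v)) - η ≤ pairL ξ v - L x v := by
  obtain ⟨v, hv⟩ := exists_lt_of_lt_ciSup
    (show (⨆ v : Evec d, (pairL ξ v - L x v)) - η < ⨆ v : Evec d, (pairL ξ v - L x v) by linarith)
  refine ⟨v, ?_, hv.le⟩
  have a1 := le_ciSup (pairL_bdd L g hsl ξ x) 0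
  have a2 : pairL ξ 0 = 0 := by simp [pairL]
  have a3 := hB x 0 (by simp)
  have a4 := pairL_le ξ v P h1 h2 hP
  have a5 := hsl (d * P + 1) (by positivity) x v
  rw [a2] at a1
  linarith

/-- Doubling of variables: existence of a maximiser. -/
lemma exists_max {d : ℕ} {X : Type*} [Finite X] [Nonempty X] (a : X → ℝ) (q : X → Evec d)
    (f : Evec d → ℝ) (hf : Continuous f) (M : ℝ) (hM : ∀ y, f y ≤ M) (k : ℝ) (hk : 0 < k) :
    ∃ x y, ∀ x' y', a x' + f y' - k * ‖y' - q x'‖ ^ 2 ≤ a x + f y - k * ‖y - q x‖ ^ 2 := by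
  have h1 : ∀ x, ∃ y, ∀ y', a x + f y' - k * ‖y' - q x‖ ^ 2 ≤ a x + f y - k * ‖y - q x‖ ^ 2 := by
    intro x
    refine Continuous.exists_forall_ge (f := fun y => a x + f y - k * ‖y - q x‖ ^ 2)
      (by fun_prop) ?_
    have t1 : Tendsto (fun y : Evec d => ‖y - q x‖) (cocompact _) atTop := by
      have := (tendsto_norm_cocompact_atTop (E := Evec d)).comp
        (Homeomorph.subRight (q x)).isClosedEmbedding.tendsto_cocompact
      exact this
    have t2 : Tendsto (fun y : Evec d => k * ‖y - q x‖ ^ 2) (cocompact _) atTop :=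
      ((tendsto_pow_atTop (two_ne_zero)).comp t1).const_mul_atTop hk
    have t3 := tendsto_atBot_add_const_left (cocompact (Evec d)) (a x + M)
      (tendsto_neg_atTop_atBot.comp t2)
    refine tendsto_atBot_mono (fun y => ?_) t3
    simp only [Function.comp]
    linarith [hM y]
  choose Y hY using h1
  obtain ⟨x, hx⟩ := Finite.exists_max (fun x => a x + f (Y x) - k * ‖Y x - q x‖ ^ 2)
  exact ⟨x, Y x, fun x' y' => (hY x' y').trans (hx x')⟩

/-- final optimisation. `s = √λ`, `t = √n`, `k = 1/(2ε) = t/(2s)`. -/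
lemma final_opt (s t A K r m : ℝ) (hs : 0 < s) (ht : 0 < t)
    (h : s ^ 2 * m ≤ A * ((t / (2 * s)) / t ^ 2) + K * r) :
    m - (t / (2 * s)) * r ^ 2 ≤ ((A + K ^ 2) / 2) * (1 / (s ^ 3 * t)) := by
  have h1 : m ≤ (A * ((t / (2 * s)) / t ^ 2) + K * r) / s ^ 2 := by
    rw [le_div_iff₀ (by positivity)]; linarith
  have h2 : 0 ≤ (t * s * r - K / s) ^ 2 * (1 / (2 * s ^ 2 * t * s ) ) := by positivity
  have h3 : (A * ((t / (2 * s)) / t ^ 2) + K * r) / s ^ 2 - (t / (2 * s)) * r ^ 2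
     = ((A + K ^ 2) / 2) * (1 / (s ^ 3 * t))
       - (t * s * r - K ) ^ 2 * (1 / (2 * s ^ 3 * t)) := by
    field_simp
    ring
  have h4 : 0 ≤ (t * s * r - K ) ^ 2 * (1 / (2 * s ^ 3 * t)) := by positivity
  linarith

lemma norm_single_add {d : ℕ} (z : Evec d) (i : Fin d) (h : ℝ) :
    ‖z - EuclideanSpace.single i h‖ ^ 2 = ‖z‖ ^ 2 - 2 * h * z i + h ^ 2 := by
  rw [norm_sub_sq_real]
  simp [EuclideanSpace.inner_single_right]
  ring

/-- Lattice maximality in the doubled functional, unwrapped through periodicity.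
Abstract `a` = `±φ`, `f` = `∓u`. -/
lemma lattice_ineq {d N : ℕ} (a : (Fin d → ZMod (N + 1)) → ℝ) (f : Evec d → ℝ)
    (hper : ∀ (x : Evec d) (i : Fin d), f (x + EuclideanSpace.single i 1) = f x) (k : ℝ)
    (x : Fin d → ZMod (N + 1)) (y : Evec d)
    (hmax : ∀ x' y', a x' + f y' - k * ‖y' - latE d (N + 1) x'‖ ^ 2
      ≤ a x + f y - k * ‖y - latE d (N + 1) x‖ ^ 2) (i : Fin d) :
    dplus a x i ≤ -(2 * k * (y - latE d (N + 1) x) i) + k / ((N : ℝ) + 1) ∧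
    dminus a x i ≤ (2 * k * (y - latE d (N + 1) x) i) + k / ((N : ℝ) + 1) := by
  have hn : (0 : ℝ) < (N : ℝ) + 1 := by positivity
  have hf : ∀ w : Evec d, (w = 0 ∨ w = EuclideanSpace.single i 1) →
      ∀ y, f (y - w) = f y ∧ f (y + w) = f y := by
    rintro w (rfl | rfl) y
    · simp
    · refine ⟨?_, hper y i⟩
      have := hper (y - EuclideanSpace.single i 1) i
      rw [sub_add_cancel] at this
      exact this.symm
  constructor
  · obtain ⟨w, hw, hwe⟩ := latE_shift x i
    have h := hmax (x + Pi.single i 1) (y - w)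
    have e : y - w - latE d (N + 1) (x + Pi.single i 1)
        = (y - latE d (N + 1) x) - EuclideanSpace.single i (1 / ((N : ℝ) + 1)) := by
      rw [sub_sub, add_comm w, hwe]; abel
    rw [e, norm_single_add, (hf w hw y).1] at h
    unfold dplus
    push_cast
    have h' : a (x + Pi.single i 1) - a x ≤ k * (- 2 * (1 / ((N : ℝ) + 1)) *
      (y - latE d (N + 1) x) i + (1 / ((N : ℝ) + 1)) ^ 2) := by linarith
    have := mul_le_mul_of_nonneg_left h' hn.le
    refine this.trans (le_of_eq ?_)
    field_simp
  · obtain ⟨w, hw, hwe⟩ := latE_shift (x - Pi.single i 1) i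
    rw [sub_add_cancel] at hwe
    have h := hmax (x - Pi.single i 1) (y + w)
    have hneg : (EuclideanSpace.single i (-(1 / ((N : ℝ) + 1))) : Evec d)
        = - EuclideanSpace.single i (1 / ((N : ℝ) + 1)) := by
      ext j; by_cases hj : j = i <;> simp [hj]
    have e : y + w - latE d (N + 1) (x - Pi.single i 1)
        = (y - latE d (N + 1) x) - EuclideanSpace.single i (-(1 / ((N : ℝ) + 1))) := by
      rw [hneg, eq_sub_of_add_eq hwe]; abel_nf
    rw [e, norm_single_add, (hf w hw y).2] at h
    unfold dminus
    push_cast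
    have h' : a (x - Pi.single i 1) - a x ≤ k * (2 * (1 / ((N : ℝ) + 1)) *
      (y - latE d (N + 1) x) i + (1 / ((N : ℝ) + 1)) ^ 2) := by linarith
    have := mul_le_mul_of_nonneg_left h' hn.le
    refine this.trans (le_of_eq ?_)
    field_simp


lemma ham_eq {d : ℕ} (L : Evec d → Evec d → ℝ) (x p : Evec d) :
    Ham d L x p = ⨆ v : Evec d, (pairL (fun i => (p i, -(p i))) v - L x v) := by
  unfold Ham
  simp only [inner_eq_pairL]

/-- rate of approximation of the viscosity solution of the stationary
Hamilton–Jacobi equation `λu + H(x, −∇u) = 0` by the solution of the discrete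
Bellman equation: `|u_λ(x) − φ_{N,λ}(x)| ≤ C₁ λ^{−3/2} N^{−1/2}` on `Λ_N`,
with `C₁` depending only on `L`. -/
theorem stmt13 (d : ℕ) (L : Evec d → Evec d → ℝ) (g : ℝ → ℝ)
    (hLc : Continuous (Function.uncurry L))
    (hconv : ∀ x : Evec d, ConvexOn ℝ Set.univ (L x))
    (hsl : ∀ a : ℝ, 0 ≤ a → ∀ (x v : Evec d), a * ‖v‖ + g a ≤ L x v)
    (hper : ∀ (x v : Evec d) (i : Fin d), L (x + EuclideanSpace.single i 1) v = L x v)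
    (hLx : ∀ c : ℝ, 0 ≤ c → ∃ K : ℝ, ∀ (x y v : Evec d), ‖v‖ ≤ c →
      |L x v - L y v| ≤ K * ‖x - y‖) :
    ∃ C : ℝ, ∀ (N : ℕ) (lam : ℝ), 0 < lam →
      ∀ u : Evec d → ℝ, Continuous u →
      (∀ (x : Evec d) (i : Fin d), u (x + EuclideanSpace.single i 1) = u x) →
      (∀ (x : Evec d) (ψ : Evec d → ℝ), ContDiff ℝ 1 ψ →
        IsLocalMin (fun y => u y - ψ y) x →
        0 ≤ lam * u x + Ham d L x (-(gradient ψ x))) →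
      (∀ (x : Evec d) (ψ : Evec d → ℝ), ContDiff ℝ 1 ψ →
        IsLocalMax (fun y => u y - ψ y) x →
        lam * u x + Ham d L x (-(gradient ψ x)) ≤ 0) →
      ∀ φ : (Fin d → ZMod (N + 1)) → ℝ,
        (∀ x, lam * φ x + HNlat L x (negDeltaN φ x) = 0) →
        ∀ x, |u (latE d (N + 1) x) - φ x|
          ≤ C * lam ^ (-(3 : ℝ) / 2) * ((N : ℝ) + 1) ^ (-(1 : ℝ) / 2) := by
  obtain ⟨B, hB⟩ := L_bdd L hLc hper
  obtain ⟨D, hD⟩ : ∃ D, D = B - g 0 := ⟨_, rfl⟩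
  have hD0 : 0 ≤ D := by
    have h1 := hsl 0 le_rfl 0 0
    have h2 := hB 0 0 (by simp)
    simp only [zero_mul, zero_add] at h1
    linarith
  obtain ⟨c, hc⟩ : ∃ c, c = max (B + 1 - g (d * (D + 1) + 1)) 0 := ⟨_, rfl⟩
  have hc0 : 0 ≤ c := hc ▸ le_max_right _ _
  have hc1 : B + 1 - g (d * (D + 1) + 1) ≤ c := hc ▸ le_max_left _ _
  obtain ⟨K, hK⟩ := hLx c hc0
  refine ⟨D + (d * c + K ^ 2) / 2, ?_⟩
  intro N lam hlam u hu huper hsup hsub φ hφ x₀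
  have hgL : ∀ x v, g 0 ≤ L x v := fun x v => by
    have := hsl 0 le_rfl x v
    linarith
  -- bounds on `u`
  obtain ⟨yM, hyM⟩ := u_max u hu huper
  obtain ⟨ym, hym⟩ := u_max (fun y => -u y) hu.neg (fun x i => by simp [huper])
  have hg0 : ∀ y : Evec d, gradient (fun _ : Evec d => (0 : ℝ)) y = 0 := fun y =>
    gradient_const (𝕜 := ℝ) y (0 : ℝ)
  have hu1 : ∀ y, lam * u y ≤ B := by
    intro y
    have h := hsub yM (fun _ => 0) contDiff_const
      (Filter.Eventually.of_forall fun z => by simpa using hyM z)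
    rw [hg0, ham_eq] at h
    have h2 := le_ciSup (pairL_bdd L g hsl (fun i => ((-(0 : Evec d)) i, -((-(0 : Evec d)) i))) yM) 0
    have h3 := hB yM 0 (by simp)
    have h4 := mul_le_mul_of_nonneg_left (hyM y) hlam.le
    have h5 : pairL (fun i => ((-(0 : Evec d)) i, -((-(0 : Evec d)) i))) (0 : Evec d) = 0 := by
      simp [pairL]
    rw [h5] at h2
    linarith
  have hu2 : ∀ y, g 0 ≤ lam * u y := by
    intro y
    have h := hsup ym (fun _ => 0) contDiff_const
      (Filter.Eventually.of_forall fun z => by simpa using hym z)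
    rw [hg0, ham_eq] at h
    have h2 : (⨆ v : Evec d, (pairL (fun i => ((-(0 : Evec d)) i, -((-(0 : Evec d)) i))) v
        - L ym v)) ≤ - g 0 := by
      apply ciSup_le
      intro v
      have h5 : pairL (fun i => ((-(0 : Evec d)) i, -((-(0 : Evec d)) i))) v = 0 := by
        simp [pairL]
      rw [h5]
      linarith [hgL ym v]
    have h3 := hym y
    have h4 := mul_le_mul_of_nonneg_left (show u ym ≤ u y by linarith) hlam.le
    linarith
  -- the discrete equation
  have hφ' : ∀ x v, pairL (negDeltaN φ x) v - L (latE d (N + 1) x) v ≤ -(lam * φ x) := by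
    intro x v
    have h := le_ciSup (pairL_bdd L g hsl (negDeltaN φ x) (latE d (N + 1) x)) v
    have h2 := hφ x
    unfold HNlat at h2
    linarith
  have hf1 : ∀ x, lam * φ x ≤ B := by
    intro x
    have h := hφ' x 0
    have h5 : pairL (negDeltaN φ x) (0 : Evec d) = 0 := by simp [pairL]
    have h3 := hB (latE d (N + 1) x) 0 (by simp)
    linarith
  have hnpos : (0 : ℝ) < (N : ℝ) + 1 := by positivity
  have hf2 : ∀ x, g 0 ≤ lam * φ x := by
    intro x
    obtain ⟨xm, hxm⟩ := Finite.exists_min φ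
    have h := hφ xm
    unfold HNlat at h
    have h2 : (⨆ v : Evec d, (pairL (negDeltaN φ xm) v - L (latE d (N + 1) xm) v)) ≤ - g 0 := by
      apply ciSup_le
      intro v
      have h5 := pairL_le (negDeltaN φ xm) v 0
        (fun i => by
          have := mul_nonneg (show (0 : ℝ) ≤ ((N + 1 : ℕ) : ℝ) by positivity)
            (sub_nonneg.2 (hxm (xm + Pi.single i 1)))
          simp only [negDeltaN, dplus]; linarith)
        (fun i => by
          have := mul_nonneg (show (0 : ℝ) ≤ ((N + 1 : ℕ) : ℝ) by positivity)
            (sub_nonneg.2 (hxm (xm - Pi.single i 1)))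
          simp only [negDeltaN, dminus]; linarith) le_rfl
      simp only [mul_zero, zero_mul] at h5
      linarith [hgL (latE d (N + 1) xm) v]
    have h4 := mul_le_mul_of_nonneg_left (hxm x) hlam.le
    linarith
  have hd1 : ∀ x i, -dplus φ x i ≤ D := by
    intro x i
    have h := hφ' x (EuclideanSpace.single i 1)
    have h3 := hB (latE d (N + 1) x) (EuclideanSpace.single i 1) (by simp)
    have h5 : pairL (negDeltaN φ x) (EuclideanSpace.single i 1) = -dplus φ x i := by
      unfold pairL
      rw [Finset.sum_eq_single i]
      · simp [negDeltaN]
      · intro j _ hj; simp [hj]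
      · simp
    linarith [hf2 x]
  have hd2 : ∀ x i, -dminus φ x i ≤ D := by
    intro x i
    have h := hφ' x (-EuclideanSpace.single i 1)
    have h3 := hB (latE d (N + 1) x) (-EuclideanSpace.single i 1) (by simp)
    have h5 : pairL (negDeltaN φ x) (-EuclideanSpace.single i 1) = -dminus φ x i := by
      unfold pairL
      rw [Finset.sum_eq_single i]
      · simp [negDeltaN]
      · intro j _ hj; simp [hj]
      · simp
    linarith [hf2 x]
  -- scaling
  obtain ⟨s, hs, hs2⟩ : ∃ s : ℝ, 0 < s ∧ s ^ 2 = lam :=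
    ⟨Real.sqrt lam, Real.sqrt_pos.2 hlam, Real.sq_sqrt hlam.le⟩
  obtain ⟨t, ht, ht2⟩ : ∃ t : ℝ, 0 < t ∧ t ^ 2 = (N : ℝ) + 1 :=
    ⟨Real.sqrt _, Real.sqrt_pos.2 hnpos, Real.sq_sqrt hnpos.le⟩
  have hrate : lam ^ (-(3 : ℝ) / 2) * ((N : ℝ) + 1) ^ (-(1 : ℝ) / 2) = 1 / (s ^ 3 * t) := by
    rw [← hs2, ← ht2, ← Real.rpow_natCast s 2, ← Real.rpow_natCast t 2, ← Real.rpow_mul hs.le,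
      ← Real.rpow_mul ht.le]
    have e1 : ((2 : ℕ) : ℝ) * (-(3 : ℝ) / 2) = -((3 : ℕ) : ℝ) := by norm_num
    have e2 : ((2 : ℕ) : ℝ) * (-(1 : ℝ) / 2) = -1 := by norm_num
    rw [e1, e2, Real.rpow_neg hs.le, Real.rpow_natCast, Real.rpow_neg_one]
    field_simp
  rw [mul_assoc, hrate]
  have hpos : 0 < 1 / (s ^ 3 * t) := by positivity
  rcases le_total (s * t) 1 with hst | hst
  · have h1 : |u (latE d (N + 1) x₀) - φ x₀| ≤ D / s ^ 2 := by
      rw [le_div_iff₀ (by positivity), hs2, mul_comm, ← abs_of_pos hlam, ← abs_mul,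
        abs_le]
      have a1 := hu1 (latE d (N + 1) x₀)
      have a2 := hu2 (latE d (N + 1) x₀)
      have a3 := hf1 x₀
      have a4 := hf2 x₀
      constructor <;> linarith
    refine h1.trans ?_
    have h2 : D / s ^ 2 ≤ D * (1 / (s ^ 3 * t)) := by
      rw [div_eq_mul_one_div]
      refine mul_le_mul_of_nonneg_left ?_ hD0
      apply one_div_le_one_div_of_le (by positivity)
      have := mul_le_mul_of_nonneg_left hst (sq_nonneg s)
      linarith
    refine h2.trans (mul_le_mul_of_nonneg_right ?_ hpos.le)
    have : 0 ≤ (d : ℝ) * c := by positivity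
    nlinarith [sq_nonneg K]
  -- main case
  have hk : 0 < t / (2 * s) := by positivity
  have hkap : (t / (2 * s)) / t ^ 2 ≤ 1 := by
    rw [div_div, div_le_one (by positivity)]
    nlinarith [mul_le_mul_of_nonneg_left hst ht.le]
  have hkap0 : 0 ≤ (t / (2 * s)) / t ^ 2 := by positivity
  obtain ⟨k, hkd⟩ : ∃ k, k = t / (2 * s) := ⟨_, rfl⟩
  rw [← hkd] at hk hkap hkap0
  have hvb : ∀ v : Evec d, ‖v‖ ≤ c → pairL (fun _ => (k / t ^ 2, k / t ^ 2)) v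
      ≤ d * c * (k / t ^ 2) := by
    intro v hv
    have h1 := sum_max_le v (k / t ^ 2) hkap0
    have h2 := mul_le_mul_of_nonneg_left hv (show 0 ≤ (d : ℝ) * (k / t ^ 2) by positivity)
    linarith
  have hfin : ∀ r m : ℝ, (∀ η, 0 < η → η ≤ 1 → lam * m ≤ d * c * (k / t ^ 2) + K * r + η) →
      m - k * r ^ 2 ≤ (D + (d * c + K ^ 2) / 2) * (1 / (s ^ 3 * t)) := by
    intro r m h
    have h1 : lam * m ≤ d * c * (k / t ^ 2) + K * r := by
      refine le_of_forall_pos_le_add fun η hη => ?_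
      have := h (min η 1) (by positivity) (min_le_right _ _)
      linarith [min_le_left η 1]
    rw [← hs2, hkd] at h1
    have h2 := final_opt s t (d * c) K r m hs ht h1
    rw [← hkd] at h2
    refine h2.trans (mul_le_mul_of_nonneg_right ?_ hpos.le)
    linarith
  rw [abs_le, neg_le, neg_sub]
  constructor
  · -- `φ - u`
    obtain ⟨x, y, hxy⟩ := exists_max φ (latE d (N + 1)) (fun y => -u y) hu.neg (-u ym) hym k hk
    have h0 := hxy x₀ (latE d (N + 1) x₀)
    have hl := lattice_ineq φ (fun y => -u y) (fun x i => by simp [huper]) k x y hxy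
    refine le_trans ?_ (hfin ‖y - latE d (N + 1) x‖ (φ x - u y) ?_)
    · simp only [sub_self, norm_zero] at h0
      linarith
    intro η hη hη1
    have hv := hsup y (fun z => (-k) * ‖z - latE d (N + 1) x‖ ^ 2) (contDiff_quad _ _)
      (Filter.Eventually.of_forall fun z => by
        have := hxy x z
        simp only
        linarith)
    rw [grad_quad, ham_eq] at hv
    rw [← ht2] at hl
    obtain ⟨v, hvc, hvm⟩ := near_max L g hsl B hB
      (fun i => ((-((2 * -k) • (y - latE d (N + 1) x)) : Evec d) i,
        -((-((2 * -k) • (y - latE d (N + 1) x)) : Evec d) i))) y (D + 1) (by linarith)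
      (fun i => by
        have := (hl i).1
        have := hd1 x i
        simp only [PiLp.neg_apply, PiLp.smul_apply, smul_eq_mul]
        linarith)
      (fun i => by
        have := (hl i).2
        have := hd2 x i
        simp only [PiLp.neg_apply, PiLp.smul_apply, smul_eq_mul]
        linarith) η hη hη1
    have hvc' := hvc.trans hc1
    have b1 := hφ' x v
    have b2 : pairL (fun i => ((-((2 * -k) • (y - latE d (N + 1) x)) : Evec d) i,
        -((-((2 * -k) • (y - latE d (N + 1) x)) : Evec d) i))) v
        ≤ pairL (fun i => ((negDeltaN φ x i).1 + k / t ^ 2, (negDeltaN φ x i).2 + k / t ^ 2)) v := by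
      apply pairL_mono
      · intro i
        have := (hl i).1
        simp only [PiLp.neg_apply, PiLp.smul_apply, smul_eq_mul, negDeltaN]
        linarith
      · intro i
        have := (hl i).2
        simp only [PiLp.neg_apply, PiLp.smul_apply, smul_eq_mul, negDeltaN]
        linarith
    rw [pairL_add] at b2
    have b3 := hvb v hvc'
    have b4 := (abs_le.1 (hK y (latE d (N + 1) x) v hvc')).1
    linarith
  · -- `u - φ`
    obtain ⟨x, y, hxy⟩ := exists_max (fun x => -φ x) (latE d (N + 1)) u hu (u yM) hyM k hk
    have h0 := hxy x₀ (latE d (N + 1) x₀)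
    have hl := lattice_ineq (fun x => -φ x) u huper k x y hxy
    refine le_trans ?_ (hfin ‖y - latE d (N + 1) x‖ (u y - φ x) ?_)
    · simp only [sub_self, norm_zero] at h0
      linarith
    intro η hη hη1
    have hv := hsub y (fun z => k * ‖z - latE d (N + 1) x‖ ^ 2) (contDiff_quad _ _)
      (Filter.Eventually.of_forall fun z => by
        have := hxy x z
        simp only
        linarith)
    rw [grad_quad, ham_eq] at hv
    rw [← ht2] at hl
    obtain ⟨v, hvc, hvm⟩ := near_max L g hsl B hB (negDeltaN φ x) (latE d (N + 1) x)
      (D + 1) (by linarith)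
      (fun i => by
        have := hd1 x i
        simp only [negDeltaN]
        linarith)
      (fun i => by
        have := hd2 x i
        simp only [negDeltaN]
        linarith) η hη hη1
    have hvc' := hvc.trans hc1
    have b0 := hφ x
    unfold HNlat at b0
    have b1 := le_ciSup (pairL_bdd L g hsl
      (fun i => ((-((2 * k) • (y - latE d (N + 1) x)) : Evec d) i,
        -((-((2 * k) • (y - latE d (N + 1) x)) : Evec d) i))) y) v
    have b2 : pairL (negDeltaN φ x) v ≤ pairL (fun i =>
        ((((fun i => ((-((2 * k) • (y - latE d (N + 1) x)) : Evec d) i,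
        -((-((2 * k) • (y - latE d (N + 1) x)) : Evec d) i))) : Fin d → ℝ × ℝ) i).1 + k / t ^ 2,
        (((fun i => ((-((2 * k) • (y - latE d (N + 1) x)) : Evec d) i,
        -((-((2 * k) • (y - latE d (N + 1) x)) : Evec d) i))) : Fin d → ℝ × ℝ) i).2
          + k / t ^ 2)) v := by
      apply pairL_mono
      · intro i
        have := (hl i).1
        simp only [PiLp.neg_apply, PiLp.smul_apply, smul_eq_mul, negDeltaN, dplus] at this ⊢
        linarith
      · intro i
        have := (hl i).2
        simp only [PiLp.neg_apply, PiLp.smul_apply, smul_eq_mul, negDeltaN, dminus] at this ⊢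
        linarith
    rw [pairL_add] at b2
    have b3 := hvb v hvc'
    have b4 := (abs_le.1 (hK y (latE d (N + 1) x) v hvc')).2
    linarith
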